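/- arXiv:2504.14397 — 2 statements merged into one kernel-verified Lean document; each statement's English description precedes it below -/
import Mathlib

section
/- Suppose H is a doubly Noetherian k-algebra, W an H-bimodule, P ⊆ T_H(W) with P ∩ H = {0}, and suppose each graded component of B_hom = T_H(W)/(lh[P]) is finitely generated as an H-bimodule. Then B = T_H(W)/(P) is a PBW deformation of B_hom (i.e., gr B ≅ B_hom as graded algebras via some isomorphism) if and only if B is a strong PBW deformation (i.e., the canonical epimorphism B_hom → gr B is an isomorphism). -/
open scoped DirectSum

noncomputable section

/-- The top (leading) degree of an element of a graded algebra. -/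
noncomputable def leadDeg {k A : Type*} [CommRing k] [Ring A] [Algebra k A]
    (𝒜 : ℕ → Submodule k A) [GradedAlgebra 𝒜] (x : A) : ℕ :=
  sSup {n | (DirectSum.decompose 𝒜 x n : A) ≠ 0}

/-- The leading homogeneous part `lh[x]` of an element of a graded algebra. -/
noncomputable def lh {k A : Type*} [CommRing k] [Ring A] [Algebra k A]
    (𝒜 : ℕ → Submodule k A) [GradedAlgebra 𝒜] (x : A) : A :=
  (DirectSum.decompose 𝒜 x (leadDeg 𝒜 x) : A)

/-- `lh[S]`, the set of leading homogeneous parts of a set. -/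
noncomputable def lhSet {k A : Type*} [CommRing k] [Ring A] [Algebra k A]
    (𝒜 : ℕ → Submodule k A) [GradedAlgebra 𝒜] (P : Set A) : Set A :=
  lh 𝒜 '' P

/-- The two-sided ideal generated by a set, as a `k`-submodule. -/
noncomputable def twoSidedSpan (k : Type*) {A : Type*} [CommRing k] [Ring A] [Algebra k A]
    (s : Set A) : Submodule k A :=
  Submodule.span k {x | ∃ a p b, p ∈ s ∧ x = a * p * b}

/-- The `n`-th filtered piece `F_n = ⊕_{i ≤ n} 𝒜 i` of a graded algebra. -/
noncomputable def filt {k A : Type*} [CommRing k] [Ring A] [Algebra k A]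
    (𝒜 : ℕ → Submodule k A) (n : ℕ) : Submodule k A :=
  ⨆ i ≤ n, 𝒜 i

/-- The `(n-1)`-st filtered piece `F_{n-1}` (with `F_{-1} = ⊥`). -/
noncomputable def filtPred {k A : Type*} [CommRing k] [Ring A] [Algebra k A]
    (𝒜 : ℕ → Submodule k A) (n : ℕ) : Submodule k A :=
  ⨆ i < n, 𝒜 i

end

open scoped TensorProduct

section
variable {k A : Type*} [Field k] [Ring A] [Algebra k A]
  (𝒜 : ℕ → Submodule k A) [GradedAlgebra 𝒜] (P : Submodule k A)

/-- Degree-`n` piece of the homogeneous version `B_hom = T_H(W)/(lh[P])`. -/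
noncomputable def homPiece (n : ℕ) :
    Submodule k (A ⧸ twoSidedSpan k (lhSet 𝒜 (P : Set A))) :=
  Submodule.map (twoSidedSpan k (lhSet 𝒜 (P : Set A))).mkQ (𝒜 n)

/-- Degree-`n` piece `F_n(B)/F_{n-1}(B)` of the associated graded algebra of
`B = T_H(W)/(P)`, presented as a submodule of `T_H(W)/((P) + F_{n-1})`. -/
noncomputable def grPiece (n : ℕ) :
    Submodule k (A ⧸ (twoSidedSpan k (P : Set A) ⊔ filtPred 𝒜 n)) :=
  Submodule.map (twoSidedSpan k (P : Set A) ⊔ filtPred 𝒜 n).mkQ (filt 𝒜 n)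

/-- `gr B ≅ B_hom` as graded algebras, via *some* isomorphism: a family of degreewise
linear equivalences which is unital and multiplicative on representatives. -/
def IsPBWDeformation : Prop :=
  ∃ e : (n : ℕ) → (homPiece 𝒜 P n ≃ₗ[k] grPiece 𝒜 P n),
    (∀ (h1 : (twoSidedSpan k (lhSet 𝒜 (P : Set A))).mkQ 1 ∈ homPiece 𝒜 P 0)
       (h1' : (twoSidedSpan k (P : Set A) ⊔ filtPred 𝒜 0).mkQ 1 ∈ grPiece 𝒜 P 0),
        e 0 ⟨(twoSidedSpan k (lhSet 𝒜 (P : Set A))).mkQ 1, h1⟩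
          = ⟨(twoSidedSpan k (P : Set A) ⊔ filtPred 𝒜 0).mkQ 1, h1'⟩) ∧
    (∀ (m n : ℕ) (x y x' y' : A), x ∈ 𝒜 m → y ∈ 𝒜 n → x' ∈ filt 𝒜 m → y' ∈ filt 𝒜 n →
      ∀ (hx : (twoSidedSpan k (lhSet 𝒜 (P : Set A))).mkQ x ∈ homPiece 𝒜 P m)
        (hx' : (twoSidedSpan k (P : Set A) ⊔ filtPred 𝒜 m).mkQ x' ∈ grPiece 𝒜 P m)
        (hy : (twoSidedSpan k (lhSet 𝒜 (P : Set A))).mkQ y ∈ homPiece 𝒜 P n)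
        (hy' : (twoSidedSpan k (P : Set A) ⊔ filtPred 𝒜 n).mkQ y' ∈ grPiece 𝒜 P n)
        (hxy : (twoSidedSpan k (lhSet 𝒜 (P : Set A))).mkQ (x * y) ∈ homPiece 𝒜 P (m + n))
        (hxy' : (twoSidedSpan k (P : Set A) ⊔ filtPred 𝒜 (m + n)).mkQ (x' * y')
            ∈ grPiece 𝒜 P (m + n)),
        e m ⟨(twoSidedSpan k (lhSet 𝒜 (P : Set A))).mkQ x, hx⟩
            = ⟨(twoSidedSpan k (P : Set A) ⊔ filtPred 𝒜 m).mkQ x', hx'⟩ →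
        e n ⟨(twoSidedSpan k (lhSet 𝒜 (P : Set A))).mkQ y, hy⟩
            = ⟨(twoSidedSpan k (P : Set A) ⊔ filtPred 𝒜 n).mkQ y', hy'⟩ →
        e (m + n) ⟨(twoSidedSpan k (lhSet 𝒜 (P : Set A))).mkQ (x * y), hxy⟩
            = ⟨(twoSidedSpan k (P : Set A) ⊔ filtPred 𝒜 (m + n)).mkQ (x' * y'), hxy'⟩)

/-- `B` is a *strong* PBW deformation: the canonical graded epimorphism `B_hom → gr B`
is injective in every degree. -/
def IsStrongPBWDeformation : Prop :=
  ∀ n, 𝒜 n ⊓ (twoSidedSpan k (P : Set A) ⊔ filtPred 𝒜 n)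
    ≤ twoSidedSpan k (lhSet 𝒜 (P : Set A))

end

namespace PBWaux

open Submodule

section
variable {k A : Type*} [Field k] [Ring A] [Algebra k A]
  (𝒜 : ℕ → Submodule k A)

lemma le_filt {i n : ℕ} (h : i ≤ n) : 𝒜 i ≤ filt 𝒜 n :=
  le_iSup₂_of_le (f := fun i (_ : i ≤ n) => 𝒜 i) i h le_rfl

lemma le_filtPred {i n : ℕ} (h : i < n) : 𝒜 i ≤ filtPred 𝒜 n :=
  le_iSup₂_of_le (f := fun i (_ : i < n) => 𝒜 i) i h le_rfl

lemma filt_le (n : ℕ) : filt 𝒜 n ≤ 𝒜 n ⊔ filtPred 𝒜 n := by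
  refine iSup₂_le fun i hi => ?_
  rcases hi.lt_or_eq with h | h
  · exact (le_filtPred 𝒜 h).trans le_sup_right
  · subst h; exact le_sup_left

variable [GradedAlgebra 𝒜] (P : Submodule k A)

lemma mul_le_add (i j : ℕ) : 𝒜 i * 𝒜 j ≤ 𝒜 (i + j) :=
  Submodule.mul_le.2 fun _ hx _ hy => SetLike.mul_mem_graded hx hy

lemma filtPred_mul {m n : ℕ} : filtPred 𝒜 m * filt 𝒜 n ≤ filtPred 𝒜 (m + n) := by
  simp only [filtPred, filt, Submodule.iSup_mul, Submodule.mul_iSup]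
  refine iSup₂_le fun i hi => iSup₂_le fun j hj => ?_
  exact (mul_le_add 𝒜 _ _).trans (le_filtPred 𝒜 (by omega))

lemma mul_filtPred {m n : ℕ} : filt 𝒜 m * filtPred 𝒜 n ≤ filtPred 𝒜 (m + n) := by
  simp only [filtPred, filt, Submodule.iSup_mul, Submodule.mul_iSup]
  refine iSup₂_le fun i hi => iSup₂_le fun j hj => ?_
  exact (mul_le_add 𝒜 _ _).trans (le_filtPred 𝒜 (by omega))

lemma span_mul_left {s : Set A} (c : A) {x : A} (hx : x ∈ twoSidedSpan k s) :
    c * x ∈ twoSidedSpan k s := by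
  unfold twoSidedSpan at *
  induction hx using Submodule.span_induction with
  | mem x hx =>
    obtain ⟨a, p, b, hp, rfl⟩ := hx
    exact subset_span ⟨c * a, p, b, hp, by simp only [mul_assoc]⟩
  | zero => simp
  | add x y _ _ hx hy => rw [mul_add]; exact add_mem hx hy
  | smul r x _ hx => rw [mul_smul_comm]; exact smul_mem _ _ hx

lemma span_mul_right {s : Set A} (c : A) {x : A} (hx : x ∈ twoSidedSpan k s) :
    x * c ∈ twoSidedSpan k s := by
  unfold twoSidedSpan at *
  induction hx using Submodule.span_induction with
  | mem x hx =>
    obtain ⟨a, p, b, hp, rfl⟩ := hx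
    exact subset_span ⟨a, p, b * c, hp, by simp only [mul_assoc]⟩
  | zero => simp
  | add x y _ _ hx hy => rw [add_mul]; exact add_mem hx hy
  | smul r x _ hx => rw [smul_mul_assoc]; exact smul_mem _ _ hx

lemma subset_twoSided {s : Set A} {x : A} (hx : x ∈ s) : x ∈ twoSidedSpan k s :=
  subset_span ⟨1, x, 1, hx, by simp⟩

lemma sub_lh_mem (p : A) : p - lh 𝒜 p ∈ filtPred 𝒜 (leadDeg 𝒜 p) := by
  classical
  have hb : BddAbove {n | (DirectSum.decompose 𝒜 p n : A) ≠ 0} := by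
    refine Set.Finite.bddAbove (((DirectSum.decompose 𝒜 p).support).finite_toSet.subset ?_)
    intro n hn
    simp only [Set.mem_ofPred_eq] at hn
    simp only [Finset.mem_coe, DFinsupp.mem_support_iff]
    intro h
    exact hn (by rw [h]; rfl)
  have key : ∀ S : Finset ℕ, (∑ i ∈ S, (DirectSum.decompose 𝒜 p i : A))
      - (if leadDeg 𝒜 p ∈ S then lh 𝒜 p else 0) ∈ filtPred 𝒜 (leadDeg 𝒜 p) := by
    intro S
    have : (if leadDeg 𝒜 p ∈ S then lh 𝒜 p else 0)
        = ∑ i ∈ S, if leadDeg 𝒜 p = i then lh 𝒜 p else 0 := by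
      rw [Finset.sum_ite_eq]
    rw [this, ← Finset.sum_sub_distrib]
    refine sum_mem fun i _ => ?_
    split_ifs with h
    · subst h; simp [lh]
    · rw [sub_zero]
      by_cases h0 : (DirectSum.decompose 𝒜 p i : A) = 0
      · rw [h0]; exact zero_mem _
      · have : i ≤ leadDeg 𝒜 p := le_csSup hb h0
        exact le_filtPred 𝒜 (by omega) (DirectSum.decompose 𝒜 p i).2
  have := key (DirectSum.decompose 𝒜 p).support
  rw [DirectSum.sum_support_decompose] at this
  split_ifs at this with h
  · exact this
  · have h0 : lh 𝒜 p = 0 := by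
      have h1 : DirectSum.decompose 𝒜 p (leadDeg 𝒜 p) = 0 := by
        by_contra h2
        exact h (DFinsupp.mem_support_iff.2 h2)
      rw [lh, h1]; rfl
    rwa [h0]

lemma lh_core {i d l : ℕ} {a b p : A} (ha : a ∈ 𝒜 i) (hb : b ∈ 𝒜 l) (hp : p ∈ P)
    (hd : d = leadDeg 𝒜 p) :
    a * lh 𝒜 p * b ∈ twoSidedSpan k (P : Set A) ⊔ filtPred 𝒜 (i + d + l) := by
  have h1 : a * p * b ∈ twoSidedSpan k (P : Set A) := subset_span ⟨a, p, b, hp, rfl⟩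
  have h2 : a * (p - lh 𝒜 p) * b ∈ filtPred 𝒜 (i + d + l) := by
    subst hd
    exact filtPred_mul 𝒜 (Submodule.mul_mem_mul (mul_filtPred 𝒜
      (Submodule.mul_mem_mul (le_filt 𝒜 le_rfl ha) (sub_lh_mem 𝒜 p))) (le_filt 𝒜 le_rfl hb))
  have : a * lh 𝒜 p * b = a * p * b - a * (p - lh 𝒜 p) * b := by noncomm_ring
  rw [this]
  exact sub_mem (mem_sup_left h1) (mem_sup_right h2)

lemma decomp_mem {x : A} (hx : x ∈ twoSidedSpan k (lhSet 𝒜 (P : Set A))) (n : ℕ) :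
    (DirectSum.decompose 𝒜 x n : A) ∈ twoSidedSpan k (P : Set A) ⊔ filtPred 𝒜 n := by
  unfold twoSidedSpan at hx
  induction hx using Submodule.span_induction with
  | mem x hx =>
    obtain ⟨a, _, b, ⟨p, hp, rfl⟩, rfl⟩ := hx
    induction a using DirectSum.Decomposition.inductionOn 𝒜 with
    | zero => simp
    | add a a' h h' =>
      rw [add_mul, add_mul, DirectSum.decompose_add]
      exact add_mem h h'
    | @homogeneous i a =>
      induction b using DirectSum.Decomposition.inductionOn 𝒜 with
      | zero => simp
      | add b b' h h' =>
        rw [mul_add, DirectSum.decompose_add]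
        exact add_mem h h'
      | @homogeneous l b =>
        have hm : (a : A) * lh 𝒜 p * b ∈ 𝒜 (i + leadDeg 𝒜 p + l) :=
          SetLike.mul_mem_graded (SetLike.mul_mem_graded a.2 (SetLike.coe_mem _)) b.2
        by_cases hn : i + leadDeg 𝒜 p + l = n
        · subst hn
          rw [DirectSum.decompose_of_mem_same 𝒜 hm]
          exact lh_core 𝒜 P a.2 b.2 hp rfl
        · rw [DirectSum.decompose_of_mem_ne 𝒜 hm hn]
          exact zero_mem _
  | zero => simp
  | add x y _ _ hx hy => rw [DirectSum.decompose_add]; exact add_mem hx hy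
  | smul r x _ hx => rw [DirectSum.decompose_smul]; exact smul_mem _ r hx

/-- projection of degree `n` onto the homogeneous piece -/
noncomputable def q (n : ℕ) : 𝒜 n →ₗ[k] homPiece 𝒜 P n :=
  ((twoSidedSpan k (lhSet 𝒜 (P : Set A))).mkQ.comp (𝒜 n).subtype).codRestrict _
    (fun x => ⟨x, x.2, rfl⟩)

/-- projection of degree `n` onto the associated graded piece -/
noncomputable def g (n : ℕ) : 𝒜 n →ₗ[k] grPiece 𝒜 P n :=
  ((twoSidedSpan k (P : Set A) ⊔ filtPred 𝒜 n).mkQ.comp (𝒜 n).subtype).codRestrict _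
    (fun x => ⟨x, le_filt 𝒜 le_rfl x.2, rfl⟩)

lemma q_surj (n : ℕ) : Function.Surjective (q 𝒜 P n) := by
  rintro ⟨_, x, hx, rfl⟩
  exact ⟨⟨x, hx⟩, rfl⟩

lemma g_surj (n : ℕ) : Function.Surjective (g 𝒜 P n) := by
  rintro ⟨_, x, hx, rfl⟩
  obtain ⟨y, hy, z, hz, rfl⟩ := mem_sup.1 (filt_le 𝒜 n hx)
  refine ⟨⟨y, hy⟩, Subtype.ext ?_⟩
  refine (Submodule.Quotient.eq _).2 ?_
  change y - (y + z) ∈ _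
  rw [sub_add_cancel_left]
  exact neg_mem (mem_sup_right hz)

lemma q_eq_zero {n : ℕ} (x : 𝒜 n) :
    q 𝒜 P n x = 0 ↔ (x : A) ∈ twoSidedSpan k (lhSet 𝒜 (P : Set A)) := by
  rw [Subtype.ext_iff]
  exact Submodule.Quotient.mk_eq_zero _

lemma g_eq_zero {n : ℕ} (x : 𝒜 n) :
    g 𝒜 P n x = 0 ↔ (x : A) ∈ twoSidedSpan k (P : Set A) ⊔ filtPred 𝒜 n := by
  rw [Subtype.ext_iff]
  exact Submodule.Quotient.mk_eq_zero _

lemma ker_le (n : ℕ) : LinearMap.ker (q 𝒜 P n) ≤ LinearMap.ker (g 𝒜 P n) := by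
  intro x hx
  rw [LinearMap.mem_ker, q_eq_zero] at hx
  rw [LinearMap.mem_ker, g_eq_zero]
  have := decomp_mem 𝒜 P hx n
  rwa [DirectSum.decompose_of_mem_same 𝒜 x.2] at this

/-- the canonical map -/
noncomputable def φ (n : ℕ) : homPiece 𝒜 P n →ₗ[k] grPiece 𝒜 P n :=
  ((LinearMap.ker (q 𝒜 P n)).liftQ (g 𝒜 P n) (ker_le 𝒜 P n)).comp
    ((q 𝒜 P n).quotKerEquivOfSurjective (q_surj 𝒜 P n)).symm.toLinearMap

lemma φ_q (n : ℕ) (x : 𝒜 n) : φ 𝒜 P n (q 𝒜 P n x) = g 𝒜 P n x := by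
  have : ((q 𝒜 P n).quotKerEquivOfSurjective (q_surj 𝒜 P n)).symm (q 𝒜 P n x)
      = (LinearMap.ker (q 𝒜 P n)).mkQ x := by
    rw [LinearEquiv.symm_apply_eq]; rfl
  simp only [φ, LinearMap.comp_apply, LinearEquiv.coe_coe, this]
  rfl

lemma φ_surj (n : ℕ) : Function.Surjective (φ 𝒜 P n) := by
  intro y
  obtain ⟨x, rfl⟩ := g_surj 𝒜 P n y
  exact ⟨_, φ_q 𝒜 P n x⟩

lemma strong_iff : IsStrongPBWDeformation 𝒜 P ↔ ∀ n, Function.Injective (φ 𝒜 P n) := by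
  unfold IsStrongPBWDeformation
  refine forall_congr' fun n => ?_
  rw [injective_iff_map_eq_zero]
  constructor
  · intro h y hy
    obtain ⟨x, rfl⟩ := q_surj 𝒜 P n y
    rw [φ_q, g_eq_zero] at hy
    exact (q_eq_zero 𝒜 P x).2 (h ⟨x.2, hy⟩)
  · rintro h x ⟨hx, hx'⟩
    exact (q_eq_zero 𝒜 P ⟨x, hx⟩).1 (h _ (by rw [φ_q, g_eq_zero]; exact hx'))

lemma strong_pbw (h : IsStrongPBWDeformation 𝒜 P) : IsPBWDeformation 𝒜 P := by
  rw [strong_iff] at h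
  have key : ∀ (n : ℕ) (x x' : A) (_ : x ∈ 𝒜 n)
      (h1 : (twoSidedSpan k (lhSet 𝒜 (P : Set A))).mkQ x ∈ homPiece 𝒜 P n)
      (h2 : (twoSidedSpan k (P : Set A) ⊔ filtPred 𝒜 n).mkQ x' ∈ grPiece 𝒜 P n),
      φ 𝒜 P n ⟨_, h1⟩ = ⟨_, h2⟩ ↔ x - x' ∈ twoSidedSpan k (P : Set A) ⊔ filtPred 𝒜 n := by
    intro n x x' hx h1 h2
    have : (⟨_, h1⟩ : homPiece 𝒜 P n) = q 𝒜 P n ⟨x, hx⟩ := rfl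
    rw [this, φ_q, Subtype.ext_iff]
    exact Submodule.Quotient.eq _
  have hb : ∀ n, Function.Bijective (φ 𝒜 P n) := fun n => ⟨h n, φ_surj 𝒜 P n⟩
  refine ⟨fun n => LinearEquiv.ofBijective (φ 𝒜 P n) (hb n), ?_, ?_⟩
  · intro h1 h1'
    simp only [LinearEquiv.ofBijective_apply]
    rw [key _ _ _ SetLike.GradedOne.one_mem]
    simp
  · intro m n x y x' y' hx hy hx' hy' h1 h2 h3 h4 h5 h6
    simp only [LinearEquiv.ofBijective_apply]
    rw [key _ _ _ hx, key _ _ _ hy, key _ _ _ (SetLike.mul_mem_graded hx hy)]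
    intro e1 e2
    have : x * y - x' * y' = (x - x') * y' + x * (y - y') := by noncomm_ring
    rw [this]
    obtain ⟨u, hu, v, hv, e1⟩ := mem_sup.1 e1
    obtain ⟨u', hu', v', hv', e2⟩ := mem_sup.1 e2
    rw [← e1, ← e2, add_mul, mul_add]
    refine add_mem (add_mem ?_ ?_) (add_mem ?_ ?_)
    · exact mem_sup_left (span_mul_right _ hu)
    · exact mem_sup_right (filtPred_mul 𝒜 (Submodule.mul_mem_mul hv hy'))
    · exact mem_sup_left (span_mul_left _ hu')
    · exact mem_sup_right (mul_filtPred 𝒜 (Submodule.mul_mem_mul (le_filt 𝒜 le_rfl hx) hv'))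

end

lemma hopf {R N V k : Type*} [Ring R] [AddCommGroup N] [Module R N] [IsNoetherian R N]
    [Field k] [AddCommGroup V] [Module k V] (π : N →+ V) (hπ : Function.Surjective π)
    (ψ : V →ₗ[k] V) (hψ : Function.Surjective ψ)
    (hc : ∀ (j : ℕ) (r : R) (y : N), (ψ ^ j) (π y) = 0 → (ψ ^ j) (π (r • y)) = 0) :
    Function.Injective ψ := by
  let f : ℕ →o Submodule R N :=
    { toFun := fun j =>
        { carrier := {y | (ψ ^ j) (π y) = 0}
          add_mem' := by
            intro a b ha hb
            simp only [Set.mem_ofPred_eq] at *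
            rw [map_add, map_add, ha, hb, add_zero]
          zero_mem' := by simp
          smul_mem' := fun r y hy => hc j r y hy }
      monotone' := by
        refine monotone_nat_of_le_succ fun j y hy => ?_
        change (ψ ^ (j + 1)) (π y) = 0
        have hy : (ψ ^ j) (π y) = 0 := hy
        rw [pow_succ', Module.End.mul_apply, hy, map_zero] }
  obtain ⟨n, hn⟩ := monotone_stabilizes_iff_noetherian.2 ‹IsNoetherian R N› f
  rw [injective_iff_map_eq_zero]
  intro v hv
  have hs : Function.Surjective (ψ ^ n) := by
    rw [Module.End.coe_pow]; exact hψ.iterate n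
  obtain ⟨w, rfl⟩ := hs v
  obtain ⟨y, rfl⟩ := hπ w
  have h1 : y ∈ f (n + 1) := by
    change (ψ ^ (n + 1)) (π y) = 0
    rw [pow_succ', Module.End.mul_apply, hv]
  rw [← hn (n + 1) (Nat.le_succ n)] at h1
  exact h1

section
variable {k A : Type*} [Field k] [Ring A] [Algebra k A]

lemma act_comm (H₀ : Subalgebra k A) (a : H₀) (b : (↥H₀)ᵐᵒᵖ) :
    Commute (((Algebra.lmul k A).comp H₀.val) a)
      (((Algebra.lsmul k k A : Aᵐᵒᵖ →ₐ[k] Module.End k A).comp (AlgHom.op H₀.val)) b) := by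
  refine LinearMap.ext fun x => ?_
  simp [mul_assoc]

/-- the bimodule action -/
noncomputable def act (H₀ : Subalgebra k A) : (H₀ ⊗[k] (↥H₀)ᵐᵒᵖ) →ₐ[k] Module.End k A :=
  Algebra.TensorProduct.lift ((Algebra.lmul k A).comp H₀.val)
    ((Algebra.lsmul k k A : Aᵐᵒᵖ →ₐ[k] Module.End k A).comp (AlgHom.op H₀.val))
    (act_comm H₀)

lemma act_tmul (H₀ : Subalgebra k A) (a : H₀) (b : (↥H₀)ᵐᵒᵖ) (x : A) :
    act H₀ (a ⊗ₜ b) x = a * x * (b.unop : A) := by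
  unfold act
  rw [Algebra.TensorProduct.lift_tmul]
  simp [mul_assoc]

lemma act_mem (𝒜 : ℕ → Submodule k A) [GradedAlgebra 𝒜] (H₀ : Subalgebra k A)
    (hH₀ : Subalgebra.toSubmodule H₀ = 𝒜 0) {n : ℕ} (r : H₀ ⊗[k] (↥H₀)ᵐᵒᵖ) {y : A}
    (hy : y ∈ 𝒜 n) : act H₀ r y ∈ 𝒜 n := by
  have hH : ∀ a : H₀, (a : A) ∈ 𝒜 0 := fun a => hH₀ ▸ a.2
  induction r using TensorProduct.induction_on with
  | zero => simp
  | add r r' h h' => rw [map_add, LinearMap.add_apply]; exact add_mem h h'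
  | tmul a b =>
    rw [act_tmul]
    have := SetLike.mul_mem_graded (SetLike.mul_mem_graded (hH a) hy) (hH b.unop)
    rwa [zero_add, add_zero] at this

end

section
variable {k A : Type*} [Field k] [Ring A] [Algebra k A]
  (𝒜 : ℕ → Submodule k A) [GradedAlgebra 𝒜] (P : Submodule k A)

lemma bimod_hopf (H₀ : Subalgebra k A) (hH₀ : Subalgebra.toSubmodule H₀ = 𝒜 0)
    [IsNoetherianRing (H₀ ⊗[k] (↥H₀)ᵐᵒᵖ)] (n : ℕ) (s : Finset A) (hs : (↑s : Set A) ⊆ 𝒜 n)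
    (hfg : 𝒜 n ≤ Submodule.span k {y | ∃ a ∈ 𝒜 0, ∃ g ∈ s, ∃ b ∈ 𝒜 0, y = a * g * b}
        ⊔ twoSidedSpan k (lhSet 𝒜 (P : Set A)))
    (ψ : homPiece 𝒜 P n →ₗ[k] homPiece 𝒜 P n) (hψ : Function.Surjective ψ)
    (hc : ∀ (j : ℕ) (a b : A) (_ : a ∈ 𝒜 0) (_ : b ∈ 𝒜 0) (y z : 𝒜 n),
      (z : A) = a * y * b → (ψ ^ j) (q 𝒜 P n y) = 0 → (ψ ^ j) (q 𝒜 P n z) = 0) :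
    Function.Injective ψ := by
  letI : Module (H₀ ⊗[k] (↥H₀)ᵐᵒᵖ) A := Module.compHom A (act H₀).toRingHom
  have smul_def : ∀ (r : H₀ ⊗[k] (↥H₀)ᵐᵒᵖ) (y : A), r • y = act H₀ r y := fun _ _ => rfl
  have hH : ∀ a : H₀, (a : A) ∈ 𝒜 0 := fun a => hH₀ ▸ a.2
  have hH' : ∀ a ∈ 𝒜 0, a ∈ H₀ := fun a ha => by
    rw [← hH₀] at ha; exact ha
  let N : Submodule (H₀ ⊗[k] (↥H₀)ᵐᵒᵖ) A := Submodule.span _ (↑s : Set A)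
  haveI : IsNoetherian (H₀ ⊗[k] (↥H₀)ᵐᵒᵖ) N :=
    isNoetherian_of_fg_of_noetherian N ⟨s, rfl⟩
  have hN : ∀ y ∈ N, y ∈ 𝒜 n := by
    intro y hy
    induction hy using Submodule.span_induction with
    | mem x hx => exact hs hx
    | zero => exact zero_mem _
    | add x y _ _ hx hy => exact add_mem hx hy
    | smul r x _ hx => rw [smul_def]; exact act_mem 𝒜 H₀ hH₀ r hx
  let π : N →+ homPiece 𝒜 P n :=
    { toFun := fun y => q 𝒜 P n ⟨y.1, hN y.1 y.2⟩
      map_zero' := map_zero (q 𝒜 P n)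
      map_add' := fun x y => map_add (q 𝒜 P n) ⟨x.1, hN x.1 x.2⟩ ⟨y.1, hN y.1 y.2⟩ }
  refine hopf (R := H₀ ⊗[k] (↥H₀)ᵐᵒᵖ) (N := N) π ?_ ψ hψ ?_
  · intro v
    obtain ⟨⟨x, hx⟩, rfl⟩ := q_surj 𝒜 P n v
    obtain ⟨y, hy, z, hz, rfl⟩ := mem_sup.1 (hfg hx)
    have hyN : y ∈ N := by
      clear hx
      induction hy using Submodule.span_induction with
      | mem x hx =>
        obtain ⟨a, ha, g, hg, b, hb, rfl⟩ := hx
        have := N.smul_mem ((⟨a, hH' a ha⟩ : H₀) ⊗ₜ[k] MulOpposite.op (⟨b, hH' b hb⟩ : H₀))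
          (Submodule.subset_span hg)
        rwa [smul_def, act_tmul] at this
      | zero => exact zero_mem _
      | add x y _ _ hx hy => exact add_mem hx hy
      | smul c x _ hx =>
        have := N.smul_mem (algebraMap k _ c) hx
        rw [smul_def, AlgHom.commutes] at this
        exact this
    refine ⟨⟨y, hyN⟩, ?_⟩
    change q 𝒜 P n ⟨y, hN y hyN⟩ = _
    rw [← sub_eq_zero, ← map_sub, q_eq_zero]
    change y - (y + z) ∈ _
    rw [sub_add_cancel_left]
    exact neg_mem hz
  · intro j r y hy
    induction r using TensorProduct.induction_on with
    | zero =>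
      have h0 : (0 : H₀ ⊗[k] (↥H₀)ᵐᵒᵖ) • y = 0 := by
        refine Subtype.ext ?_
        change act H₀ 0 y.1 = 0
        rw [map_zero, LinearMap.zero_apply]
      exact (congrArg (fun t => (ψ ^ j) (π t)) h0).trans (by simp only [map_zero])
    | add r r' h h' => rw [add_smul, map_add, map_add, h, h', add_zero]
    | tmul a b =>
      refine hc j a b.unop (hH a) (hH _) ⟨y.1, hN y.1 y.2⟩ ⟨_, hN _ (((a ⊗ₜ[k] b) • y).2)⟩ ?_ hy
      change act H₀ (a ⊗ₜ[k] b) y.1 = _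
      rw [act_tmul]

end

end PBWaux

/-- Suppose the `k`-algebra `H` (realized as the degree-zero subalgebra `H₀`
of `A = T_H(W)`) is doubly Noetherian, `P ⊆ T_H(W)` is a `k`-subspace with `P ∩ H = 0`,
and each graded component of `B_hom = T_H(W)/(lh[P])` is finitely generated as an
`H`-bimodule.  Then `B = T_H(W)/(P)` is a PBW deformation of `B_hom` (some graded algebra
isomorphism `gr B ≅ B_hom` exists) if and only if it is a strong PBW deformation (the
canonical epimorphism `B_hom → gr B` is an isomorphism). -/
theorem stmt_7 {k A : Type*} [Field k] [Ring A] [Algebra k A]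
    (𝒜 : ℕ → Submodule k A) [GradedAlgebra 𝒜]
    (hgen : ∀ n, 𝒜 (n + 1) = 𝒜 1 * 𝒜 n)
    (H₀ : Subalgebra k A) (hH₀ : Subalgebra.toSubmodule H₀ = 𝒜 0)
    [IsNoetherianRing (H₀ ⊗[k] (↥H₀)ᵐᵒᵖ)]
    (P : Submodule k A) (hP : P ⊓ 𝒜 0 = ⊥)
    (hfg : ∀ n, ∃ s : Finset A, (↑s : Set A) ⊆ 𝒜 n ∧
      𝒜 n ≤ Submodule.span k {y | ∃ a ∈ 𝒜 0, ∃ g ∈ s, ∃ b ∈ 𝒜 0, y = a * g * b}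
        ⊔ twoSidedSpan k (lhSet 𝒜 (P : Set A))) :
    IsPBWDeformation 𝒜 P ↔ IsStrongPBWDeformation 𝒜 P := by
  refine ⟨?_, PBWaux.strong_pbw 𝒜 P⟩
  rintro ⟨e, -, hmul⟩
  rw [PBWaux.strong_iff]
  intro n
  let ψ : (n : ℕ) → homPiece 𝒜 P n →ₗ[k] homPiece 𝒜 P n :=
    fun n => (e n).symm.toLinearMap.comp (PBWaux.φ 𝒜 P n)
  have ψ_iff : ∀ (n : ℕ) (x x' : 𝒜 n), ψ n (PBWaux.q 𝒜 P n x) = PBWaux.q 𝒜 P n x' ↔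
      e n (PBWaux.q 𝒜 P n x') = PBWaux.g 𝒜 P n x := by
    intro n x x'
    change (e n).symm (PBWaux.φ 𝒜 P n (PBWaux.q 𝒜 P n x)) = _ ↔ _
    rw [PBWaux.φ_q, LinearEquiv.symm_apply_eq, eq_comm]
  have ψ_mul : ∀ (m n l : ℕ) (_ : m + n = l) (x x' : 𝒜 m) (y y' : 𝒜 n) (z z' : 𝒜 l),
      (z : A) = x * y → (z' : A) = x' * y' →
      ψ m (PBWaux.q 𝒜 P m x) = PBWaux.q 𝒜 P m x' →
      ψ n (PBWaux.q 𝒜 P n y) = PBWaux.q 𝒜 P n y' →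
      ψ l (PBWaux.q 𝒜 P l z) = PBWaux.q 𝒜 P l z' := by
    rintro m n _ rfl ⟨x, hx⟩ ⟨x', hx'⟩ ⟨y, hy⟩ ⟨y', hy'⟩ ⟨z, hz⟩ ⟨z', hz'⟩ h h' h1 h2
    simp only at h h'
    subst h h'
    rw [ψ_iff] at *
    exact hmul m n x' y' x y hx' hy' (PBWaux.le_filt 𝒜 le_rfl hx) (PBWaux.le_filt 𝒜 le_rfl hy)
      _ _ _ _ ⟨_, hz', rfl⟩ ⟨_, PBWaux.le_filt 𝒜 le_rfl hz, rfl⟩ h1 h2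
  have hinj : Function.Injective (ψ n) := by
    obtain ⟨s, hs, hs'⟩ := hfg n
    refine PBWaux.bimod_hopf 𝒜 P H₀ hH₀ n s hs hs' (ψ n)
      ((e n).symm.surjective.comp (PBWaux.φ_surj 𝒜 P n)) ?_
    intro j
    induction j with
    | zero =>
      intro a b _ _ y z hz h
      rw [pow_zero, Module.End.one_apply, PBWaux.q_eq_zero] at *
      rw [hz]
      exact PBWaux.span_mul_right _ (PBWaux.span_mul_left _ h)
    | succ j ih =>
      intro a b ha hb y z hz h
      rw [pow_succ, Module.End.mul_apply] at *
      obtain ⟨y', hy'⟩ := PBWaux.q_surj 𝒜 P n (ψ n (PBWaux.q 𝒜 P n y))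
      obtain ⟨a', ha'⟩ := PBWaux.q_surj 𝒜 P 0 (ψ 0 (PBWaux.q 𝒜 P 0 ⟨a, ha⟩))
      obtain ⟨b', hb'⟩ := PBWaux.q_surj 𝒜 P 0 (ψ 0 (PBWaux.q 𝒜 P 0 ⟨b, hb⟩))
      have m1 : a * (y : A) ∈ 𝒜 n := by
        have := SetLike.mul_mem_graded ha y.2
        rwa [zero_add] at this
      have m2 : (a' : A) * (y' : A) ∈ 𝒜 n := by
        have := SetLike.mul_mem_graded a'.2 y'.2
        rwa [zero_add] at this
      have m3 : (a' : A) * (y' : A) * (b' : A) ∈ 𝒜 n := SetLike.mul_mem_graded m2 b'.2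
      have e1 := ψ_mul 0 n n (zero_add n) ⟨a, ha⟩ a' y y' ⟨_, m1⟩ ⟨_, m2⟩ rfl rfl ha'.symm hy'.symm
      have e2 := ψ_mul n 0 n (add_zero n) ⟨_, m1⟩ ⟨_, m2⟩ ⟨b, hb⟩ b' z ⟨_, m3⟩ hz rfl e1 hb'.symm
      rw [e2]
      rw [← hy'] at h
      exact ih a' b' a'.2 b'.2 y' ⟨_, m3⟩ rfl h
  exact Function.Injective.of_comp (f := (e n).symm) hinj
end

section
/- Let H be a Hopf algebra over a field k acting on a finitely generated quadratic algebra S = T(V)/(R) (with V finite dimensional in degree 1, R ⊆ V⊗V, and the H-action preserving the grading). Then the smash product S # H is isomorphic as a graded algebra to T_H(H⊗V⊗H)/(R ∪ R'), where R' = span_k{ h⊗v⊗1_H − 1_H⊗τ(h⊗v) : h∈H, v∈V } with τ(h⊗v) = Σ (h₁·v)⊗h₂. -/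
open scoped TensorProduct

noncomputable section

namespace PaperTH

variable (k H V : Type*) [CommRing k] [Ring H] [AddCommGroup V] [Module k V]

section AlgebraPart
variable [Algebra k H]

/-- The free algebra on the `k`-module `H ⊕ V`; the tensor algebra over `H` of the free
`H`-bimodule `H ⊗ V ⊗ H` is the quotient of this by the relations `baseSet` below. -/
abbrev TF := TensorAlgebra k (H × V)

/-- The `H`-generators. -/
noncomputable def jH : H →ₗ[k] TF k H V := (TensorAlgebra.ι k).comp (LinearMap.inl k H V)

/-- The `V`-generators (degree 1). -/
noncomputable def jV : V →ₗ[k] TF k H V := (TensorAlgebra.ι k).comp (LinearMap.inr k H V)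

/-- Presentation relation: the relations making `H ↪ T_H(H⊗V⊗H)` an algebra map, together
with an arbitrary set `Q` of further relations set equal to `0`.  Thus
`RingQuot (presRel Q)` models `T_H(H⊗V⊗H)/(Q)`. -/
inductive presRel (Q : Set (TF k H V)) : TF k H V → TF k H V → Prop
  | mulH (h h' : H) : presRel Q (jH k H V h * jH k H V h') (jH k H V (h * h'))
  | oneH : presRel Q (jH k H V 1) 1
  | mem {x : TF k H V} : x ∈ Q → presRel Q x 0

/-- Elements generating the two-sided ideal presenting `T_H(H⊗V⊗H)` from the free algebra. -/
def baseSet : Set (TF k H V) :=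
  {x | (∃ h h', x = jH k H V h * jH k H V h' - jH k H V (h * h')) ∨ x = jH k H V 1 - 1}

/-- The two-sided ideal generated by a set, as a `k`-submodule. -/
noncomputable def twoSidedSpan {A : Type*} [Ring A] [Algebra k A] (s : Set A) :
    Submodule k A :=
  Submodule.span k {x | ∃ a p b, p ∈ s ∧ x = a * p * b}

/-- Degree-0 piece `H` (with its unit). -/
noncomputable def HF : Submodule k (TF k H V) := LinearMap.range (jH k H V) ⊔ 1

/-- The `V`-part. -/
noncomputable def VF : Submodule k (TF k H V) := LinearMap.range (jV k H V)

/-- Degree-`n` piece of `T_H(H⊗V⊗H)`: sums of `h₀ v₁ h₁ ⋯ v_n h_n`. -/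
noncomputable def gradeF (n : ℕ) : Submodule k (TF k H V) :=
  HF k H V * (VF k H V * HF k H V) ^ n

/-- Filtration `F_n`. -/
noncomputable def filtF (n : ℕ) : Submodule k (TF k H V) := ⨆ i ≤ n, gradeF k H V i

/-- `F_{n-1}` (with `F_{-1} = ⊥`). -/
noncomputable def filtFpred (n : ℕ) : Submodule k (TF k H V) := ⨆ i < n, gradeF k H V i

/-- The image of `V ⊗ V` in degree 2. -/
noncomputable def iVV : V ⊗[k] V →ₗ[k] TF k H V :=
  (LinearMap.mul' k (TF k H V)).comp (TensorProduct.map (jV k H V) (jV k H V))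

/-- The image of `V ⊗ H` in degree 1. -/
noncomputable def iVH : V ⊗[k] H →ₗ[k] TF k H V :=
  (LinearMap.mul' k (TF k H V)).comp (TensorProduct.map (jV k H V) (jH k H V))

end AlgebraPart

section BialgebraPart
variable [Bialgebra k H]

/-- The twisting map `τ : H ⊗ V → V ⊗ H`, `h ⊗ v ↦ Σ (h₁ · v) ⊗ h₂`. -/
noncomputable def twistTau (act : H ⊗[k] V →ₗ[k] V) :
    H ⊗[k] V →ₗ[k] V ⊗[k] H :=
  (TensorProduct.map act LinearMap.id)
    ∘ₗ (TensorProduct.assoc k H V H).symm.toLinearMap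
    ∘ₗ (TensorProduct.map LinearMap.id (TensorProduct.comm k H V).toLinearMap)
    ∘ₗ (TensorProduct.assoc k H H V).toLinearMap
    ∘ₗ (TensorProduct.map Coalgebra.comul LinearMap.id)

/-- The diagonal action of `H` on `V ⊗ V`. -/
noncomputable def diag2 (act : H ⊗[k] V →ₗ[k] V) :
    H ⊗[k] (V ⊗[k] V) →ₗ[k] V ⊗[k] V :=
  (TensorProduct.map act act)
    ∘ₗ (TensorProduct.tensorTensorTensorComm k H H V V).toLinearMap
    ∘ₗ (TensorProduct.map Coalgebra.comul LinearMap.id)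

/-- The span of the smash relations `h ⊗ v ⊗ 1 − 1 ⊗ τ(h ⊗ v)`, viewed inside `TF`. -/
noncomputable def smashSet (act : H ⊗[k] V →ₗ[k] V) : Set (TF k H V) :=
  (Submodule.span k {x | ∃ (h : H) (v : V),
    x = jH k H V h * jV k H V v - iVH k H V (twistTau k H V act (h ⊗ₜ[k] v))} :
      Submodule k (TF k H V))

end BialgebraPart

end PaperTH

end

open PaperTH

/-- The image of `V ⊗ V` in degree 2 of the tensor algebra `T(V)`. -/
noncomputable def tensVV (k V : Type*) [CommRing k] [AddCommGroup V] [Module k V] :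
    V ⊗[k] V →ₗ[k] TensorAlgebra k V :=
  (LinearMap.mul' k (TensorAlgebra k V)).comp
    (TensorProduct.map (TensorAlgebra.ι k) (TensorAlgebra.ι k))

/-- Relations presenting the quadratic algebra `S = T(V)/(R)`. -/
inductive quadRel (k V : Type*) [CommRing k] [AddCommGroup V] [Module k V]
    (R : Submodule k (V ⊗[k] V)) : TensorAlgebra k V → TensorAlgebra k V → Prop
  | mem {r : V ⊗[k] V} : r ∈ R → quadRel k V R (tensVV k V r) 0

/-- The quadratic algebra `S = T(V)/(R)`. -/
abbrev QuadAlg (k V : Type*) [CommRing k] [AddCommGroup V] [Module k V]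
    (R : Submodule k (V ⊗[k] V)) := RingQuot (quadRel k V R)

/-- The degree-`n` component of `S = T(V)/(R)`. -/
noncomputable def quadGrade (k V : Type*) [CommRing k] [AddCommGroup V] [Module k V]
    (R : Submodule k (V ⊗[k] V)) (n : ℕ) : Submodule k (QuadAlg k V R) :=
  Submodule.map (RingQuot.mkAlgHom k (quadRel k V R)).toLinearMap
    ((LinearMap.range (TensorAlgebra.ι k : V →ₗ[k] TensorAlgebra k V)) ^ n)

/-- The smash-product multiplication on the `k`-module `S ⊗ H`:
`(s ⊗ h)(s' ⊗ h') = Σ s (h₁ · s') ⊗ h₂ h'`, expressed via the twisting map `τ`. -/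
noncomputable def mulSmash (k H S : Type*) [CommRing k] [Ring H] [Bialgebra k H]
    [Ring S] [Algebra k S] (act : H ⊗[k] S →ₗ[k] S) :
    (S ⊗[k] H) ⊗[k] (S ⊗[k] H) →ₗ[k] S ⊗[k] H :=
  (TensorProduct.map (LinearMap.mul' k S) (LinearMap.mul' k H))
    ∘ₗ (TensorProduct.assoc k S S (H ⊗[k] H)).symm.toLinearMap
    ∘ₗ (TensorProduct.map LinearMap.id (TensorProduct.assoc k S H H).toLinearMap)
    ∘ₗ (TensorProduct.map LinearMap.id
        (TensorProduct.map (twistTau k H S act) LinearMap.id))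
    ∘ₗ (TensorProduct.map LinearMap.id (TensorProduct.assoc k H S H).symm.toLinearMap)
    ∘ₗ (TensorProduct.assoc k S H (S ⊗[k] H)).toLinearMap

open scoped TensorProduct
open scoped Coalgebra

namespace SmashAux

lemma map_sub_zero {k A E : Type*} [CommSemiring k] [Ring A] [Semiring E] [Algebra k A]
    [Algebra k E] (f : A →ₐ[k] E) (a c : A) (h : f a = f c) : f (a - c) = 0 := by
  rw [sub_eq_add_neg, map_add, h, ← map_add, add_neg_cancel, map_zero]

section generic
variable {k H S : Type*} [CommRing k] [Ring H] [Bialgebra k H]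

lemma twist_apply {M : Type*} [AddCommGroup M] [Module k M] (act : H ⊗[k] M →ₗ[k] M)
    (h : H) (s : M) {ι : Type*} (r : Coalgebra.Repr k h ι) :
    twistTau k H M act (h ⊗ₜ[k] s)
      = ∑ i ∈ r.index, act (r.left i ⊗ₜ[k] s) ⊗ₜ[k] r.right i := by
  simp [twistTau, ← r.eq, TensorProduct.sum_tmul, map_sum]

variable [Ring S] [Algebra k S]

/-- The action as an algebra map into endomorphisms. -/
noncomputable def actHom (act : H ⊗[k] S →ₗ[k] S)
    (hone : ∀ s : S, act ((1 : H) ⊗ₜ[k] s) = s)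
    (hmul : ∀ (h h' : H) (s : S), act ((h * h') ⊗ₜ[k] s) = act (h ⊗ₜ[k] act (h' ⊗ₜ[k] s))) :
    H →ₐ[k] Module.End k S :=
  AlgHom.ofLinearMap (TensorProduct.curry act)
    (by ext s; simp [hone]) (by intro x y; ext s; simp [hmul])

/-- The left multiplication by elements of `H` on `S # H`. -/
noncomputable def LH (act : H ⊗[k] S →ₗ[k] S)
    (hone : ∀ s : S, act ((1 : H) ⊗ₜ[k] s) = s)
    (hmul : ∀ (h h' : H) (s : S), act ((h * h') ⊗ₜ[k] s) = act (h ⊗ₜ[k] act (h' ⊗ₜ[k] s))) :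
    H →ₐ[k] Module.End k (S ⊗[k] H) :=
  ((Module.endTensorEndAlgHom (R := k) (S := k) (A := k) (M := S) (N := H)).comp
    (Algebra.TensorProduct.map (actHom act hone hmul) (Algebra.lmul k H))).comp
      (Bialgebra.comulAlgHom k H)

lemma LH_apply (act : H ⊗[k] S →ₗ[k] S) (hone) (hmul) (h : H) (s : S) (h' : H)
    {ι : Type*} (r : Coalgebra.Repr k h ι) :
    LH act hone hmul h (s ⊗ₜ[k] h')
      = ∑ i ∈ r.index, act (r.left i ⊗ₜ[k] s) ⊗ₜ[k] (r.right i * h') := by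
  simp [LH, ← r.eq, map_sum, Module.endTensorEndAlgHom_apply, LinearMap.sum_apply, actHom]

lemma mulSmash_apply (act : H ⊗[k] S →ₗ[k] S) (hone) (hmul) (s : S) (h : H) (u : S ⊗[k] H) :
    mulSmash k H S act ((s ⊗ₜ[k] h) ⊗ₜ[k] u)
      = TensorProduct.map (LinearMap.mulLeft k s) LinearMap.id (LH act hone hmul h u) := by
  induction u using TensorProduct.induction_on with
  | zero => simp
  | add x y hx hy => simp only [TensorProduct.tmul_add, map_add, hx, hy]
  | tmul s' h' =>
    rw [LH_apply act hone hmul h s' h' (ℛ k h)]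
    simp [mulSmash, twist_apply act h s' (ℛ k h), TensorProduct.sum_tmul, TensorProduct.tmul_sum]

lemma coassoc_sum {M : Type*} [AddCommGroup M] [Module k M] (G : H ⊗[k] (H ⊗[k] H) →ₗ[k] M)
    (h : H) :
    ∑ i ∈ (ℛ k h).index, ∑ j ∈ (ℛ k ((ℛ k h).left i)).index,
      G ((ℛ k ((ℛ k h).left i)).left j ⊗ₜ ((ℛ k ((ℛ k h).left i)).right j ⊗ₜ (ℛ k h).right i))
    = ∑ i ∈ (ℛ k h).index, ∑ j ∈ (ℛ k ((ℛ k h).right i)).index,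
      G ((ℛ k h).left i ⊗ₜ
        ((ℛ k ((ℛ k h).right i)).left j ⊗ₜ (ℛ k ((ℛ k h).right i)).right j)) := by
  have := congrArg G (Coalgebra.sum_tmul_tmul_eq (ℛ k h)
    (fun i => ℛ k ((ℛ k h).left i)) (fun i => ℛ k ((ℛ k h).right i)))
  simpa only [map_sum] using this

/-- the product rule -/
def ProdRule (act : H ⊗[k] S →ₗ[k] S) : Prop :=
  act ∘ₗ (TensorProduct.map LinearMap.id (LinearMap.mul' k S))
      = (LinearMap.mul' k S)
        ∘ₗ (TensorProduct.map act act)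
        ∘ₗ (TensorProduct.tensorTensorTensorComm k H H S S).toLinearMap
        ∘ₗ (TensorProduct.map Coalgebra.comul LinearMap.id)

lemma act_mul (act : H ⊗[k] S →ₗ[k] S) (halg : ProdRule act) (h : H) (s t : S)
    {ι : Type*} (r : Coalgebra.Repr k h ι) :
    act (h ⊗ₜ[k] (s * t))
      = ∑ i ∈ r.index, act (r.left i ⊗ₜ[k] s) * act (r.right i ⊗ₜ[k] t) := by
  have := LinearMap.congr_fun halg (h ⊗ₜ[k] (s ⊗ₜ[k] t))
  simpa [← r.eq, TensorProduct.sum_tmul, map_sum] using this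

lemma twist_mul {B : Type*} [Ring B] [Algebra k B] (act : H ⊗[k] S →ₗ[k] S)
    (halg : ProdRule act) (α : S →ₐ[k] B) (β : H →ₗ[k] B) (h : H) (s t : S) :
    (∑ i ∈ (ℛ k h).index, α (act ((ℛ k h).left i ⊗ₜ[k] (s * t))) * β ((ℛ k h).right i))
    = ∑ i ∈ (ℛ k h).index, α (act ((ℛ k h).left i ⊗ₜ[k] s)) *
      ∑ j ∈ (ℛ k ((ℛ k h).right i)).index,
        α (act ((ℛ k ((ℛ k h).right i)).left j ⊗ₜ[k] t)) * β ((ℛ k ((ℛ k h).right i)).right j) := by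
  have := coassoc_sum (k := k) (H := H)
    ((LinearMap.mul' k B) ∘ₗ TensorProduct.map
      (α.toLinearMap ∘ₗ act ∘ₗ (TensorProduct.mk k H S).flip s)
      ((LinearMap.mul' k B) ∘ₗ TensorProduct.map
        (α.toLinearMap ∘ₗ act ∘ₗ (TensorProduct.mk k H S).flip t) β)) h
  simp only [LinearMap.comp_apply, TensorProduct.map_tmul, LinearMap.mul'_apply,
    LinearMap.flip_apply, TensorProduct.mk_apply, AlgHom.toLinearMap_apply] at this
  simp only [Finset.mul_sum]
  rw [← this]
  refine Finset.sum_congr rfl fun i _ => ?_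
  rw [act_mul act halg _ s t (ℛ k ((ℛ k h).left i)), map_sum, Finset.sum_mul]
  simp only [map_mul, mul_assoc]

lemma LH_mul (act : H ⊗[k] S →ₗ[k] S) (hone) (hmul) (halg : ProdRule act)
    (h : H) (s : S) :
    LH act hone hmul h * TensorProduct.map (LinearMap.mulLeft k s) LinearMap.id
    = ∑ i ∈ (ℛ k h).index,
        TensorProduct.map (LinearMap.mulLeft k (act ((ℛ k h).left i ⊗ₜ[k] s))) LinearMap.id *
          LH act hone hmul ((ℛ k h).right i) := by
  ext t h'
  have := coassoc_sum (k := k) (H := H)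
    (TensorProduct.map (LinearMap.mul' k S) (LinearMap.mulRight k h') ∘ₗ
      (TensorProduct.assoc k S S H).symm.toLinearMap ∘ₗ
      TensorProduct.map
      (act ∘ₗ (TensorProduct.mk k H S).flip s)
      (TensorProduct.map
        (act ∘ₗ (TensorProduct.mk k H S).flip t) LinearMap.id)) h
  simp at this
  simp only [TensorProduct.AlgebraTensorModule.curry_apply, TensorProduct.curry_apply,
    LinearMap.restrictScalars_self, Module.End.mul_apply, TensorProduct.map_tmul,
    LinearMap.mulLeft_apply, LinearMap.id_apply, LinearMap.sum_apply]
  rw [LH_apply act hone hmul h _ _ (ℛ k h)]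
  refine Eq.trans ?_ (this.trans ?_)
  · refine Finset.sum_congr rfl fun i _ => ?_
    rw [act_mul act halg _ s t (ℛ k ((ℛ k h).left i)), TensorProduct.sum_tmul]
  · refine Finset.sum_congr rfl fun i _ => ?_
    rw [LH_apply act hone hmul _ _ _ (ℛ k ((ℛ k h).right i))]
    simp

lemma LH_one (act : H ⊗[k] S →ₗ[k] S) (hone) (hmul)
    (hunit : ∀ h : H, act (h ⊗ₜ[k] (1 : S)) = (Coalgebra.counit (R := k) h : k) • (1 : S))
    (h : H) : LH act hone hmul h (1 ⊗ₜ[k] 1) = 1 ⊗ₜ[k] h := by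
  rw [LH_apply act hone hmul h _ _ (ℛ k h)]
  simp only [hunit, mul_one, TensorProduct.smul_tmul]
  rw [← TensorProduct.tmul_sum, Coalgebra.sum_counit_smul]

lemma grade_aux {B : Type*} [Ring B] [Algebra k B] (K W : Submodule k B)
    (h1 : 1 ≤ K) (hK : K * K ≤ K) (hKW : K * W ≤ W * K) (n : ℕ) :
    K * (W * K) ^ n = W ^ n * K := by
  induction n with
  | zero => simp
  | succ n ih =>
    rw [pow_succ, ← mul_assoc, ih, mul_assoc, pow_succ, mul_assoc]
    congr 1
    apply le_antisymm
    · calc K * (W * K) = (K * W) * K := by rw [mul_assoc]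
        _ ≤ (W * K) * K := mul_le_mul_left hKW _
        _ = W * (K * K) := by rw [mul_assoc]
        _ ≤ W * K := mul_le_mul_right hK _
    · calc W * K = 1 * (W * K) := by rw [one_mul]
        _ ≤ _ := mul_le_mul_left h1 _

lemma range_aux {B : Type*} [Ring B] [Algebra k B] (P : Submodule k S) (α : S →ₗ[k] B)
    (β : H →ₗ[k] B) :
    Submodule.map (LinearMap.mul' k B ∘ₗ TensorProduct.map α β)
      (LinearMap.range (TensorProduct.map P.subtype (LinearMap.id : H →ₗ[k] H)))
    = Submodule.map α P * LinearMap.range β := by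
  apply le_antisymm
  · rintro _ ⟨_, ⟨x, rfl⟩, rfl⟩
    induction x using TensorProduct.induction_on with
    | zero => simp
    | add x y hx hy => simpa only [map_add] using add_mem hx hy
    | tmul s h =>
      simp only [TensorProduct.map_tmul, LinearMap.comp_apply, LinearMap.mul'_apply]
      exact Submodule.mul_mem_mul ⟨s, s.2, rfl⟩ ⟨h, rfl⟩
  · rw [Submodule.mul_le]
    rintro _ ⟨s, hs, rfl⟩ _ ⟨h, rfl⟩
    exact ⟨s ⊗ₜ h, ⟨(⟨s, hs⟩ : P) ⊗ₜ h, by simp⟩, by simp⟩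

end generic

end SmashAux

/-- Let the Hopf algebra `H` act on the finitely generated quadratic algebra
`S = T(V)/(R)` (V finite-dimensional, action a Hopf-module-algebra action preserving the
grading, restricting on degree 1 to `actV`, which preserves `R`).  Then the smash product
`S # H` — the `k`-module `S ⊗ H` with the smash multiplication — is isomorphic as a
graded algebra to `T_H(H⊗V⊗H)/(R ∪ R')`, where `R'` is the span of the smash relations
`h ⊗ v ⊗ 1 − 1 ⊗ τ(h ⊗ v)`. -/
theorem stmt_8 {k H V : Type*} [Field k] [Ring H] [HopfAlgebra k H]
    [AddCommGroup V] [Module k V] [Module.Finite k V]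
    (R : Submodule k (V ⊗[k] V))
    (actV : H ⊗[k] V →ₗ[k] V)
    (honeV : ∀ v : V, actV ((1 : H) ⊗ₜ[k] v) = v)
    (hmulV : ∀ (h h' : H) (v : V),
      actV ((h * h') ⊗ₜ[k] v) = actV (h ⊗ₜ[k] actV (h' ⊗ₜ[k] v)))
    (hRpres : ∀ h : H, ∀ r ∈ R, diag2 k H V actV (h ⊗ₜ[k] r) ∈ R)
    (act : H ⊗[k] (QuadAlg k V R) →ₗ[k] QuadAlg k V R)
    (hone : ∀ s : QuadAlg k V R, act ((1 : H) ⊗ₜ[k] s) = s)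
    (hmul : ∀ (h h' : H) (s : QuadAlg k V R),
      act ((h * h') ⊗ₜ[k] s) = act (h ⊗ₜ[k] act (h' ⊗ₜ[k] s)))
    (hunit : ∀ h : H, act (h ⊗ₜ[k] (1 : QuadAlg k V R)) = (Coalgebra.counit (R := k) h : k) • (1 : QuadAlg k V R))
    (halg : act ∘ₗ (TensorProduct.map LinearMap.id (LinearMap.mul' k (QuadAlg k V R)))
      = (LinearMap.mul' k (QuadAlg k V R))
        ∘ₗ (TensorProduct.map act act)
        ∘ₗ (TensorProduct.tensorTensorTensorComm k H H
              (QuadAlg k V R) (QuadAlg k V R)).toLinearMap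
        ∘ₗ (TensorProduct.map Coalgebra.comul LinearMap.id))
    (hgrading : ∀ (h : H) (n : ℕ), ∀ s ∈ quadGrade k V R n,
      act (h ⊗ₜ[k] s) ∈ quadGrade k V R n)
    (hcompat : ∀ (h : H) (v : V),
      act (h ⊗ₜ[k] (RingQuot.mkAlgHom k (quadRel k V R) (TensorAlgebra.ι k v)))
        = RingQuot.mkAlgHom k (quadRel k V R) (TensorAlgebra.ι k (actV (h ⊗ₜ[k] v)))) :
    ∃ Φ : RingQuot (presRel k H V
            ((iVV k H V '' (R : Set (V ⊗[k] V))) ∪ smashSet k H V actV))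
          ≃ₗ[k] (QuadAlg k V R) ⊗[k] H,
      Φ 1 = (1 : QuadAlg k V R) ⊗ₜ[k] (1 : H) ∧
      (∀ x y, Φ (x * y) = mulSmash k H (QuadAlg k V R) act (Φ x ⊗ₜ[k] Φ y)) ∧
      (∀ n, Submodule.map Φ.toLinearMap
          (Submodule.map (RingQuot.mkAlgHom k (presRel k H V
              ((iVV k H V '' (R : Set (V ⊗[k] V))) ∪ smashSet k H V actV))).toLinearMap
            (gradeF k H V n))
        = LinearMap.range (TensorProduct.map (quadGrade k V R n).subtype
            (LinearMap.id : H →ₗ[k] H))) := by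
  classical
  set S := QuadAlg k V R with hS
  set Q : Set (TF k H V) := (iVV k H V '' (R : Set (V ⊗[k] V))) ∪ smashSet k H V actV with hQ
  set σ : TensorAlgebra k V →ₐ[k] S := RingQuot.mkAlgHom k (quadRel k V R) with hσ
  set π : TF k H V →ₐ[k] RingQuot (presRel k H V Q) :=
    RingQuot.mkAlgHom k (presRel k H V Q) with hπ
  have hπs : Function.Surjective π := RingQuot.mkAlgHom_surjective k _
  have hσs : Function.Surjective σ := RingQuot.mkAlgHom_surjective k _
  have hσR : ∀ r ∈ R, σ (tensVV k V r) = 0 := fun r hr => by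
    rw [hσ, RingQuot.mkAlgHom_rel k (quadRel.mem hr), map_zero]
  have hπQ : ∀ x ∈ Q, π x = 0 := fun x hx => by
    rw [hπ, RingQuot.mkAlgHom_rel k (presRel.mem hx), map_zero]
  -- the algebra map from `H`
  let β : H →ₐ[k] RingQuot (presRel k H V Q) :=
    AlgHom.ofLinearMap (π.toLinearMap ∘ₗ jH k H V)
      (by
        have := RingQuot.mkAlgHom_rel k (presRel.oneH (k := k) (H := H) (V := V) (Q := Q))
        simpa using this)
      (by
        intro x y
        have := RingQuot.mkAlgHom_rel k (presRel.mulH (k := k) (H := H) (V := V) (Q := Q) x y)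
        simpa using this.symm)
  have hβ : ∀ h, β h = π (jH k H V h) := fun h => rfl
  -- the algebra map from `S`
  let α0 : TensorAlgebra k V →ₐ[k] RingQuot (presRel k H V Q) :=
    TensorAlgebra.lift k (π.toLinearMap ∘ₗ jV k H V)
  have hα0 : ∀ v, α0 (TensorAlgebra.ι k v) = π (jV k H V v) := fun v => by simp [α0]
  have hα0R : ∀ r, α0 (tensVV k V r) = π (iVV k H V r) := fun r => by
    have : α0.toLinearMap ∘ₗ tensVV k V = π.toLinearMap ∘ₗ iVV k H V := by
      ext v w
      simp [tensVV, iVV, hα0]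
    exact LinearMap.congr_fun this r
  let α : S →ₐ[k] RingQuot (presRel k H V Q) :=
    RingQuot.liftAlgHom k ⟨α0, by
      rintro _ _ ⟨hr⟩
      rw [hα0R, map_zero]
      exact hπQ _ (Or.inl ⟨_, hr, rfl⟩)⟩
  have hασ : ∀ x, α (σ x) = α0 x := fun x => by
    simp only [α, hσ]
    exact RingQuot.liftAlgHom_mkAlgHom_apply k _ _ _
  have hsmash : ∀ (h : H) (v : V), π (jH k H V h) * π (jV k H V v)
      = π (iVH k H V (twistTau k H V actV (h ⊗ₜ[k] v))) := fun h v => by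
    rw [← map_mul, ← sub_eq_zero, ← map_sub]
    exact hπQ _ (Or.inr (Submodule.subset_span ⟨h, v, rfl⟩))
  -- commutation
  have hcomm : ∀ (s : S) (h : H), β h * α s
      = ∑ i ∈ (ℛ k h).index, α (act ((ℛ k h).left i ⊗ₜ[k] s)) * β ((ℛ k h).right i) := by
    intro s
    obtain ⟨x, rfl⟩ := hσs s
    induction x using TensorAlgebra.induction with
    | algebraMap r =>
      intro h
      rw [AlgHom.commutes, Algebra.algebraMap_eq_smul_one]
      simp only [TensorProduct.tmul_smul, map_smul, hunit, map_one, smul_mul_assoc, one_mul,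
        mul_smul_comm, mul_one]
      rw [← Finset.smul_sum]
      congr 1
      conv_lhs => rw [← Coalgebra.sum_counit_smul (ℛ k h)]
      simp
    | ι v =>
      intro h
      rw [hασ, hα0, hβ, hsmash, SmashAux.twist_apply actV h v (ℛ k h)]
      simp [iVH, hcompat, hασ, hα0, hβ]
    | mul a b ha hb =>
      intro h
      rw [map_mul]
      have := SmashAux.twist_mul act halg α β.toLinearMap h (σ a) (σ b)
      simp only [AlgHom.toLinearMap_apply] at this
      rw [this, map_mul, ← mul_assoc, ha, Finset.sum_mul]
      refine Finset.sum_congr rfl fun i _ => ?_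
      rw [mul_assoc, hb]
    | add a b ha hb =>
      intro h
      simp only [map_add, mul_add, ha, hb, TensorProduct.tmul_add, add_mul, Finset.sum_add_distrib]
  -- representation of the target on `S ⊗ H`
  let ML : S →ₐ[k] Module.End k (S ⊗[k] H) :=
    (Module.endTensorEndAlgHom (R := k) (S := k) (A := k) (M := S) (N := H)).comp
      (Algebra.TensorProduct.includeLeft.comp (Algebra.lmul k S))
  have hML : ∀ s, ML s = TensorProduct.map (LinearMap.mulLeft k s) LinearMap.id := fun s => rfl
  let L := SmashAux.LH act hone hmul
  have hL : ∀ (h : H) (s : S), L h * ML s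
    = ∑ i ∈ (ℛ k h).index, ML (act ((ℛ k h).left i ⊗ₜ[k] s)) * L ((ℛ k h).right i) :=
    fun h s => SmashAux.LH_mul act hone hmul halg h s
  let ρ0 : TF k H V →ₐ[k] Module.End k (S ⊗[k] H) :=
    TensorAlgebra.lift k (LinearMap.coprod L.toLinearMap
      (ML.toLinearMap ∘ₗ σ.toLinearMap ∘ₗ TensorAlgebra.ι k))
  have hρ0H : ∀ h, ρ0 (jH k H V h) = L h := fun h => by simp [ρ0, jH]
  have hρ0V : ∀ v, ρ0 (jV k H V v) = ML (σ (TensorAlgebra.ι k v)) := fun v => by simp [ρ0, jV]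
  have hρ0R : ∀ r, ρ0 (iVV k H V r) = ML (σ (tensVV k V r)) := fun r => by
    have : ρ0.toLinearMap ∘ₗ iVV k H V = (ML.toLinearMap ∘ₗ σ.toLinearMap) ∘ₗ tensVV k V := by
      apply TensorProduct.ext'
      intro v w
      simp [tensVV, iVV, hρ0V]
    exact LinearMap.congr_fun this r
  have hρ0S : smashSet k H V actV ⊆ (LinearMap.ker ρ0.toLinearMap : Set (TF k H V)) := by
    apply Submodule.span_le.2
    rintro _ ⟨h, v, rfl⟩
    have key : ρ0 (jH k H V h * jV k H V v)
        = ρ0 (iVH k H V (twistTau k H V actV (h ⊗ₜ[k] v))) := by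
      rw [map_mul, hρ0H, hρ0V, hL, SmashAux.twist_apply actV h v (ℛ k h)]
      simp only [map_sum, iVH, LinearMap.comp_apply, TensorProduct.map_tmul, LinearMap.mul'_apply,
        map_mul, hρ0V, hρ0H, hcompat]
    exact LinearMap.mem_ker.2 (SmashAux.map_sub_zero ρ0 _ _ key)
  let ρ : RingQuot (presRel k H V Q) →ₐ[k] Module.End k (S ⊗[k] H) :=
    RingQuot.liftAlgHom k ⟨ρ0, by
      intro x y hxy
      cases hxy with
      | mulH h h' => rw [map_mul, hρ0H, hρ0H, hρ0H, map_mul]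
      | oneH => rw [hρ0H, map_one, map_one]
      | mem hx =>
        rw [map_zero]
        rcases hx with ⟨r, hr, rfl⟩ | hx
        · rw [hρ0R, hσR r hr, map_zero]
        · exact hρ0S hx⟩
  have hρπ : ∀ x, ρ (π x) = ρ0 x := fun x => by
    simp only [ρ, hπ]
    exact RingQuot.liftAlgHom_mkAlgHom_apply k _ _ _
  have hρβ : ∀ h, ρ (β h) = L h := fun h => by rw [hβ, hρπ, hρ0H]
  have hρα : ∀ s, ρ (α s) = ML s := by
    intro s
    obtain ⟨x, rfl⟩ := hσs s
    rw [hασ]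
    have : ρ.comp α0 = ML.comp σ := by
      apply TensorAlgebra.hom_ext
      ext1 v
      change ρ (α0 (TensorAlgebra.ι k v)) = ML (σ (TensorAlgebra.ι k v))
      rw [hα0, hρπ, hρ0V]
    exact AlgHom.congr_fun this x
  let Φ : RingQuot (presRel k H V Q) →ₗ[k] S ⊗[k] H :=
    (LinearMap.applyₗ ((1 : S) ⊗ₜ[k] (1 : H))) ∘ₗ ρ.toLinearMap
  have hΦ : ∀ x, Φ x = ρ x (1 ⊗ₜ 1) := fun x => rfl
  let Ψ : S ⊗[k] H →ₗ[k] RingQuot (presRel k H V Q) :=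
    LinearMap.mul' k _ ∘ₗ TensorProduct.map α.toLinearMap β.toLinearMap
  have hΨ : ∀ s h, Ψ (s ⊗ₜ h) = α s * β h := fun s h => by simp [Ψ]
  have hΦΨ : ∀ t, Φ (Ψ t) = t := by
    intro t
    induction t using TensorProduct.induction_on with
    | zero => simp
    | add x y hx hy => rw [map_add, map_add, hx, hy]
    | tmul s h =>
      rw [hΨ, hΦ, map_mul, hρα, hρβ, Module.End.mul_apply, SmashAux.LH_one act hone hmul hunit,
        hML]
      simp
  have hΨL : ∀ h t, Ψ (L h t) = β h * Ψ t := by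
    intro h t
    induction t using TensorProduct.induction_on with
    | zero => simp
    | add x y hx hy => simp only [map_add, mul_add, hx, hy]
    | tmul s h' =>
      rw [SmashAux.LH_apply act hone hmul h s h' (ℛ k h), hΨ, ← mul_assoc, hcomm, map_sum,
        Finset.sum_mul]
      simp only [hΨ, map_mul, mul_assoc]
  have hΨM : ∀ s t, Ψ (ML s t) = α s * Ψ t := by
    intro s t
    induction t using TensorProduct.induction_on with
    | zero => simp
    | add x y hx hy => simp only [map_add, mul_add, hx, hy]
    | tmul s' h' => rw [hML]; simp [hΨ, mul_assoc]
  have hΨρ : ∀ x t, Ψ (ρ x t) = x * Ψ t := by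
    intro x
    obtain ⟨x, rfl⟩ := hπs x
    induction x using TensorAlgebra.induction with
    | algebraMap r => intro t; simp [Algebra.algebraMap_eq_smul_one]
    | ι p =>
      intro t
      obtain ⟨h, v⟩ := p
      have hp : TensorAlgebra.ι k (h, v) = jH k H V h + jV k H V v := by
        simp only [jH, jV, LinearMap.comp_apply, ← map_add]
        simp
      rw [hp, map_add, map_add, LinearMap.add_apply, map_add, add_mul, ← hβ, ← hα0, ← hασ, hρβ,
        hρα, hΨL, hΨM]
    | mul a b ha hb => intro t; rw [map_mul, map_mul, Module.End.mul_apply, ha, hb, mul_assoc]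
    | add a b ha hb =>
      intro t; rw [map_add, map_add, LinearMap.add_apply, map_add, ha, hb, add_mul]
  have hΨΦ : ∀ x, Ψ (Φ x) = x := fun x => by
    rw [hΦ, hΨρ, hΨ, map_one, map_one, mul_one, mul_one]
  have hmulS : ∀ t u, mulSmash k H S act (t ⊗ₜ u) = ρ (Ψ t) u := by
    intro t u
    induction t using TensorProduct.induction_on with
    | zero => simp
    | add x y hx hy =>
      simp only [TensorProduct.add_tmul, map_add, hx, hy, LinearMap.add_apply]
    | tmul s h =>
      rw [SmashAux.mulSmash_apply act hone hmul, hΨ, map_mul, hρα, hρβ, Module.End.mul_apply, hML]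
  let E : RingQuot (presRel k H V Q) ≃ₗ[k] S ⊗[k] H :=
    LinearEquiv.ofLinearMap Φ Ψ (LinearMap.ext hΦΨ) (LinearMap.ext hΨΦ)
  refine ⟨E, ?_, ?_, ?_⟩
  · change Φ 1 = _
    rw [hΦ, map_one, Module.End.one_apply]
  · intro x y
    change Φ (x * y) = mulSmash k H S act (Φ x ⊗ₜ Φ y)
    rw [hmulS, hΨΦ, hΦ, hΦ, map_mul, Module.End.mul_apply]
  · intro n
    have hinj : Function.Injective (Submodule.map Ψ) :=
      Submodule.map_injective_of_injective (f := Ψ) (fun a b hab => by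
        rw [← hΦΨ a, ← hΦΨ b, hab])
    apply hinj
    have hE : E.toLinearMap = Φ := rfl
    have hcomp : Ψ ∘ₗ Φ = LinearMap.id := LinearMap.ext hΨΦ
    rw [hE, ← Submodule.map_comp, hcomp, Submodule.map_id, SmashAux.range_aux]
    set K : Submodule k (RingQuot (presRel k H V Q)) := LinearMap.range β.toLinearMap with hK
    have hHF : Submodule.map π.toLinearMap (HF k H V) = K := by
      have h1 : (1 : Submodule k (RingQuot (presRel k H V Q))) ≤ K := by
        rw [Submodule.one_le]; exact ⟨1, map_one β⟩
      rw [HF, Submodule.map_sup, ← LinearMap.range_comp, Submodule.map_one]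
      exact sup_eq_left.2 h1
    set W := Submodule.map π.toLinearMap (VF k H V) with hW
    have hWα : Submodule.map α.toLinearMap (quadGrade k V R n) = W ^ n := by
      rw [quadGrade, ← Submodule.map_comp]
      have : α.toLinearMap ∘ₗ (RingQuot.mkAlgHom k (quadRel k V R)).toLinearMap
          = α0.toLinearMap := LinearMap.ext hασ
      rw [this, Submodule.map_pow, hW, VF, ← LinearMap.range_comp, ← LinearMap.range_comp]
      congr 2
      exact LinearMap.ext hα0
    rw [hWα, gradeF, Submodule.map_mul, Submodule.map_pow, Submodule.map_mul, hHF]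
    apply SmashAux.grade_aux
    · rw [Submodule.one_le]; exact ⟨1, map_one β⟩
    · rw [Submodule.mul_le]
      rintro _ ⟨a, rfl⟩ _ ⟨b, rfl⟩
      exact ⟨a * b, map_mul β a b⟩
    · rw [Submodule.mul_le]
      rintro _ ⟨h, rfl⟩ _ ⟨_, ⟨v, rfl⟩, rfl⟩
      change π (jH k H V h) * π (jV k H V v) ∈ _
      rw [hsmash, SmashAux.twist_apply actV h v (ℛ k h)]
      simp only [map_sum, iVH, LinearMap.comp_apply, TensorProduct.map_tmul,
        LinearMap.mul'_apply, map_mul]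
      exact Submodule.sum_mem _ fun i _ =>
        Submodule.mul_mem_mul ⟨_, ⟨_, rfl⟩, rfl⟩ ⟨_, rfl⟩
end
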